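/- With the λ's defined by the generating-function formula and the p's defined by the elimination recursion, the following identities hold in B_g for all odd j, k with 3 ≤ j ≤ k ≤ 2g−1 (δ denotes the Kronecker delta; b_{i,l} = 0 for l > 2g−1, p_{k,l} = 0 if k > 2g−1 or l > 2g−1, λ_s = 0 for s > 4g+2): (1) b_{3,1} = 6b_{1,1}² + 4b_{1,3} + 2λ₄; (2) b_{3,k} = 6b_{1,1}b_{1,k} + 6b_{1,k+2} − p_{3,k}; (3) b_{2,1}² = 4b_{1,1}³ + 4b_{1,1}b_{1,3} − 4b_{1,5} + 2p_{3,3} + 4λ₄b_{1,1} + 4λ₆; (4) b_{2,1}b_{2,k} = 4b_{1,1}²b_{1,k} + 2b_{1,3}b_{1,k} + 4b_{1,1}b_{1,k+2} − 2b_{1,k+4} − b_{1,1}p_{3,k} + 2p_{3,k+2} − p_{5,k} + 2λ₄b_{1,k} + 2λ₈δ_{3,k}; (5) b_{2,j}b_{2,k} = 4b_{1,1}b_{1,j}b_{1,k} + 4b_{1,k}b_{1,j+2} + 4b_{1,j}b_{1,k+2} + 2p_{k+2,j+2} − b_{1,j}p_{3,k} − b_{1,k}p_{3,j} − p_{k,j+4}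 − p_{j,k+4} + 2λ_{j+k+4}(2δ_{j,k} + δ_{k,j−2} + δ_{j,k−2}). Consequently, the generating-function formula computes the polynomial map ρ_g obtained by solving these relations for the λ's and p's in terms of the b's. -/

import Mathlib

open MvPolynomial

noncomputable section

/-- B_g = ℂ[b_{i,j} : i ∈ {1,2,3}, j odd, 1 ≤ j ≤ 2g−1], as a polynomial ring in 3g variables;
the variable (i, m) : Fin 3 × Fin g stands for b_{i+1, 2m+1}. -/
abbrev Bg (g : ℕ) : Type := MvPolynomial (Fin 3 × Fin g) ℂ

/-- `bb g i m` is the variable b_{i, 2m−1} (zero if i ∉ {1,2,3} or m ∉ {1,…,g}). -/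
noncomputable def bb (g : ℕ) (i m : ℕ) : Bg g :=
  if h : 1 ≤ i ∧ i ≤ 3 ∧ 1 ≤ m ∧ m ≤ g then
    MvPolynomial.X (⟨i - 1, by omega⟩, ⟨m - 1, by omega⟩) else 0

/-- `bv g i j` is the variable b_{i,j} for odd j (zero for j > 2g−1). -/
noncomputable def bv (g : ℕ) (i j : ℕ) : Bg g :=
  if Odd j then bb g i ((j + 1) / 2) else 0

/-- `Qg g a c` is p_{2a−1, 2c−1} for 1 ≤ a ≤ c, by the elimination recursion. -/
noncomputable def Qg (g : ℕ) : ℕ → ℕ → Bg g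
  | 0, _ => 0
  | 1, c => 2 * bb g 1 c
  | 2, c => 6 * bb g 1 1 * bb g 1 c - bb g 3 c + 6 * bb g 1 (c + 1)
  | 3, c => bb g 3 1 * bb g 1 c - bb g 2 1 * bb g 2 c + bb g 1 1 * bb g 3 c
      - 2 * (4 * bb g 1 1 ^ 2 + bb g 1 2) * bb g 1 c
      + 10 * bb g 1 1 * bb g 1 (c + 1) - 2 * bb g 3 (c + 1) + 10 * bb g 1 (c + 2)
  | (a + 4), c => 2 * (if c + 1 ≤ g then Qg g (a + 3) (c + 1) else 0)
      - (if c + 2 ≤ g then Qg g (a + 2) (c + 2) else 0)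
      - 8 * bb g 1 1 * bb g 1 (a + 2) * bb g 1 c - 2 * bb g 1 c * bb g 1 (a + 3)
      - 2 * bb g 1 (a + 2) * bb g 1 (c + 1) + bb g 1 (a + 2) * bb g 3 c
      - bb g 2 (a + 2) * bb g 2 c + bb g 3 (a + 2) * bb g 1 c

/-- `pp g k l` is p_{k,l} for odd k, l (zero if k > 2g−1 or l > 2g−1). -/
noncomputable def pp (g : ℕ) (k l : ℕ) : Bg g :=
  if Odd k ∧ Odd l ∧ k ≤ 2 * g - 1 ∧ l ≤ 2 * g - 1 then
    if k ≤ l then Qg g ((k + 1) / 2) ((l + 1) / 2) else Qg g ((l + 1) / 2) ((k + 1) / 2)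
  else 0

/-- 𝐛ᵢ(ξ) = Σ_{m=1}^{g} b_{i,2m−1} ξᵐ ∈ B_g[ξ]. -/
noncomputable def Bcoef (g i : ℕ) : Polynomial (Bg g) :=
  ∑ m ∈ Finset.Icc 1 g, Polynomial.C (bb g i m) * Polynomial.X ^ m

/-- The polynomial ξ𝐛₂(ξ)² + 2ξ𝐛₃(ξ)(1 − 𝐛₁(ξ)) + 4(1 + 2b_{1,1}ξ)(1 − 𝐛₁(ξ))². -/
noncomputable def Fg (g : ℕ) : Polynomial (Bg g) :=
  Polynomial.X * (Bcoef g 2) ^ 2 + 2 * Polynomial.X * Bcoef g 3 * (1 - Bcoef g 1)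
    + 4 * (1 + 2 * Polynomial.C (bb g 1 1) * Polynomial.X) * (1 - Bcoef g 1) ^ 2

/-- `lam g m` is λ_{2m+2}, defined by 4λ_{2m+2} = coefficient of ξ^{m+1} in `Fg g`. -/
noncomputable def lam (g m : ℕ) : Bg g := ((1 : ℂ) / 4) • ((Fg g).coeff (m + 1))

theorem bb_eq_zero_of_lt {g m : ℕ} (i : ℕ) (h : g < m) : bb g i m = 0 :=
  dif_neg (by omega)

theorem bb_index_zero (g i : ℕ) : bb g i 0 = 0 :=
  dif_neg (by omega)

theorem Bcoef_coeff (g i m : ℕ) : (Bcoef g i).coeff m = bb g i m := by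
  have h : m ∉ Finset.Icc 1 g → bb g i m = 0 := fun hm =>
    dif_neg fun h => hm (Finset.mem_Icc.2 h.2.2)
  simpa [Bcoef, Polynomial.finsetSum_coeff, Polynomial.coeff_C_mul, Polynomial.coeff_X_pow,
    eq_comm] using h

/-- Convolution of the coefficient sequences of `Bcoef g i` and `Bcoef g i'`. -/
def bbConv (g i i' n : ℕ) : Bg g :=
  ∑ p ∈ Finset.HasAntidiagonal.antidiagonal n, bb g i p.1 * bb g i' p.2

theorem Bcoef_mul_coeff (g i i' n : ℕ) :
    (Bcoef g i * Bcoef g i').coeff n = bbConv g i i' n := by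
  simp [Polynomial.coeff_mul, Bcoef_coeff, bbConv]

theorem four_mul_lam (g n : ℕ) (hn : n ≠ 0) :
    4 * lam g n = bbConv g 2 2 n + 2 * bb g 3 n - 2 * bbConv g 3 1 n
      - 8 * bb g 1 (n + 1) + 4 * bbConv g 1 1 (n + 1)
      - 16 * bb g 1 1 * bb g 1 n + 8 * bb g 1 1 * bbConv g 1 1 n := by
  have hF : Fg g = (Bcoef g 2 * Bcoef g 2 + Polynomial.C 2 * Bcoef g 3
      - Polynomial.C 2 * (Bcoef g 3 * Bcoef g 1)
      + Polynomial.C (8 * bb g 1 1) * (1 : Polynomial (Bg g))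
      - Polynomial.C (16 * bb g 1 1) * Bcoef g 1
      + Polynomial.C (8 * bb g 1 1) * (Bcoef g 1 * Bcoef g 1)) * Polynomial.X
      + (Polynomial.C 4 - Polynomial.C 8 * Bcoef g 1
        + Polynomial.C 4 * (Bcoef g 1 * Bcoef g 1)) := by
    simp only [Fg, map_mul, map_ofNat]
    ring
  have h4 : 4 * lam g n = (Fg g).coeff (n + 1) := by
    have : (4 : Bg g) = MvPolynomial.C (4 : ℂ) := (map_ofNat MvPolynomial.C 4).symm
    rw [lam, MvPolynomial.smul_eq_C_mul, this, ← mul_assoc, ← map_mul]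
    norm_num
  rw [h4, hF]
  simp only [Polynomial.coeff_add, Polynomial.coeff_sub, Polynomial.coeff_mul_X,
    Polynomial.coeff_C_mul, Bcoef_mul_coeff, Bcoef_coeff, Polynomial.coeff_one, hn, if_false,
    Polynomial.coeff_C_succ]
  ring

/-- The quadratic inhomogeneity of the elimination recursion. -/
def recTerm (g a c : ℕ) : Bg g :=
  -8 * bb g 1 1 * bb g 1 a * bb g 1 c - 2 * bb g 1 c * bb g 1 (a + 1)
    - 2 * bb g 1 a * bb g 1 (c + 1) + bb g 1 a * bb g 3 c
    - bb g 2 a * bb g 2 c + bb g 3 a * bb g 1 c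

theorem recTerm_comm (g a c : ℕ) : recTerm g a c = recTerm g c a := by
  unfold recTerm; ring

theorem Qg_eq_zero_of_lt {g c : ℕ} (a : ℕ) (h : g < c) : Qg g a c = 0 := by
  have h0 (i) : bb g i c = 0 := bb_eq_zero_of_lt i h
  have h1 (i) : bb g i (c + 1) = 0 := bb_eq_zero_of_lt i (by omega)
  have h2 (i) : bb g i (c + 2) = 0 := bb_eq_zero_of_lt i (by omega)
  have h3 : ¬ c + 1 ≤ g := by omega
  have h4 : ¬ c + 2 ≤ g := by omega
  match a with
  | 0 => simp [Qg]
  | 1 => simp [Qg, h0]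
  | 2 => simp [Qg, h0, h1]
  | 3 => simp [Qg, h0, h1, h2]
  | a + 4 => simp [Qg, h0, h1, h3, h4]

theorem Qg_two (g c : ℕ) :
    Qg g 2 c = 6 * bb g 1 1 * bb g 1 c - bb g 3 c + 6 * bb g 1 (c + 1) := by
  rw [Qg]

theorem Qg_add_four (g a c : ℕ) :
    Qg g (a + 4) c = 2 * Qg g (a + 3) (c + 1) - Qg g (a + 2) (c + 2) + recTerm g (a + 2) c := by
  have h (a c : ℕ) : (if c ≤ g then Qg g a c else 0) = Qg g a c := by
    split_ifs with hc
    · rfl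
    · exact (Qg_eq_zero_of_lt a (by omega)).symm
  rw [Qg, h, h, recTerm]
  ring

theorem sum_recTerm (g n : ℕ) (hn : n ≠ 0) :
    ∑ p ∈ Finset.HasAntidiagonal.antidiagonal n, recTerm g p.1 p.2 =
      2 * bb g 3 n - 8 * bb g 1 (n + 1) - 16 * bb g 1 1 * bb g 1 n - 4 * lam g n := by
  have e1 : ∑ p ∈ Finset.HasAntidiagonal.antidiagonal n, bb g 1 (p.1 + 1) * bb g 1 p.2 = bbConv g 1 1 (n + 1) := by
    rw [bbConv, Finset.Nat.sum_antidiagonal_succ]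
    simp [bb_index_zero]
  have e2 : ∑ p ∈ Finset.HasAntidiagonal.antidiagonal n, bb g 1 p.1 * bb g 1 (p.2 + 1) = bbConv g 1 1 (n + 1) := by
    rw [bbConv, Finset.Nat.sum_antidiagonal_succ']
    simp [bb_index_zero]
  have e3 : ∑ p ∈ Finset.HasAntidiagonal.antidiagonal n, bb g 1 p.1 * bb g 3 p.2 = bbConv g 3 1 n := by
    rw [bbConv, ← Finset.Nat.sum_antidiagonal_swap]
    exact Finset.sum_congr rfl fun p _ => mul_comm _ _
  have e : ∑ p ∈ Finset.HasAntidiagonal.antidiagonal n, recTerm g p.1 p.2 =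
      -8 * bb g 1 1 * bbConv g 1 1 n
      - 2 * ∑ p ∈ Finset.HasAntidiagonal.antidiagonal n, bb g 1 (p.1 + 1) * bb g 1 p.2
      - 2 * ∑ p ∈ Finset.HasAntidiagonal.antidiagonal n, bb g 1 p.1 * bb g 1 (p.2 + 1)
      + ∑ p ∈ Finset.HasAntidiagonal.antidiagonal n, bb g 1 p.1 * bb g 3 p.2
      - bbConv g 2 2 n + bbConv g 3 1 n := by
    simp only [bbConv, Finset.mul_sum, ← Finset.sum_add_distrib, ← Finset.sum_sub_distrib]
    refine Finset.sum_congr rfl fun p _ => ?_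
    unfold recTerm
    ring
  rw [e, e1, e2, e3, four_mul_lam g n hn]
  ring

theorem sum_antidiagonal_peel {M : Type*} [AddCommMonoid M] (f : ℕ → ℕ → M) (n : ℕ) :
    ∑ p ∈ Finset.HasAntidiagonal.antidiagonal (n + 2), f p.1 p.2 =
      f 0 (n + 2) + f (n + 2) 0 + ∑ p ∈ Finset.HasAntidiagonal.antidiagonal n, f (p.1 + 1) (p.2 + 1) := by
  rw [Finset.Nat.sum_antidiagonal_succ, Finset.Nat.sum_antidiagonal_succ', ← add_assoc]

/-- First differences of `Qg` along an antidiagonal, as a partial sum of the recursion. -/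
theorem two_mul_Qg_sub (g a d : ℕ) :
    2 * Qg g (a + 2) (a + d + 4) - 2 * Qg g (a + 3) (a + d + 3) = 4 * lam g (2 * a + d + 4)
      + ∑ p ∈ Finset.HasAntidiagonal.antidiagonal d, recTerm g (a + 2 + p.1) (a + 2 + p.2) := by
  induction a generalizing d with
  | zero =>
    have h := sum_recTerm g (d + 4) (by omega)
    rw [sum_antidiagonal_peel (recTerm g) (d + 2),
      sum_antidiagonal_peel (fun x y => recTerm g (x + 1) (y + 1)) d] at h
    have e (p : ℕ × ℕ) : recTerm g (0 + 2 + p.1) (0 + 2 + p.2)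
        = recTerm g (p.1 + 1 + 1) (p.2 + 1 + 1) := by congr 1 <;> omega
    simp only [e]
    simp only [mul_zero, zero_add, recTerm_comm g (d + 2 + 2) 0,
      recTerm_comm g (d + 2 + 1) 1] at h ⊢
    generalize ∑ p ∈ Finset.HasAntidiagonal.antidiagonal d,
      recTerm g (p.1 + 1 + 1) (p.2 + 1 + 1) = S at h ⊢
    simp only [recTerm, bb_index_zero, Qg, add_assoc, Nat.reduceAdd] at h ⊢
    linear_combination -h
  | succ a ih =>
    have h := ih (d + 2)
    rw [sum_antidiagonal_peel (fun x y => recTerm g (a + 2 + x) (a + 2 + y)),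
      recTerm_comm g (a + 2 + (d + 2))] at h
    have e (p : ℕ × ℕ) : recTerm g (a + 1 + 2 + p.1) (a + 1 + 2 + p.2)
        = recTerm g (a + 2 + (p.1 + 1)) (a + 2 + (p.2 + 1)) := by congr 1 <;> omega
    have hr := Qg_add_four g a (a + d + 4)
    simp only [e]
    rw [show 2 * (a + 1) + d + 4 = 2 * a + (d + 2) + 4 by ring,
      show a + 1 + d + 4 = a + (d + 2) + 3 by ring, show a + 1 + d + 3 = a + d + 4 by ring,
      show a + 1 + 2 = a + 3 by ring, show a + 1 + 3 = a + 4 by ring]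
    rw [show a + d + 4 + 1 = a + (d + 2) + 3 by ring,
      show a + d + 4 + 2 = a + (d + 2) + 4 by ring] at hr
    rw [show a + 2 + (d + 2) = a + d + 4 by ring] at h
    simp only [add_zero] at h
    linear_combination h - 2 * hr

theorem Qg_diag (g a : ℕ) :
    2 * Qg g (a + 2) (a + 4) - 2 * Qg g (a + 3) (a + 3) =
      4 * lam g (2 * a + 4) + recTerm g (a + 2) (a + 2) := by
  simpa using two_mul_Qg_sub g a 0

theorem Qg_offdiag (g a : ℕ) :
    Qg g (a + 2) (a + 5) - Qg g (a + 3) (a + 4) =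
      2 * lam g (2 * a + 5) + recTerm g (a + 2) (a + 3) := by
  have h := two_mul_Qg_sub g a 1
  rw [Finset.Nat.sum_antidiagonal_succ] at h
  simp only [add_zero, zero_add, Finset.HasAntidiagonal.antidiagonal_zero, Finset.sum_singleton, add_assoc,
    Nat.reduceAdd] at h
  rw [recTerm_comm g (a + 3)] at h
  refine mul_left_cancel₀ (two_ne_zero (α := Bg g)) ?_
  linear_combination h

theorem bv_odd (g i m : ℕ) : bv g i (2 * m + 1) = bb g i (m + 1) := by
  rw [bv, if_pos ⟨m, rfl⟩]
  congr 1
  omega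

theorem pp_comm (g k l : ℕ) : pp g k l = pp g l k := by
  rcases lt_trichotomy k l with h | h | h
  · simp [pp, h.le, h.not_ge, and_comm, and_left_comm]
  · rw [h]
  · simp [pp, h.le, h.not_ge, and_comm, and_left_comm]

theorem pp_odd {a c : ℕ} (g : ℕ) (h : a ≤ c) :
    pp g (2 * a + 1) (2 * c + 1) = Qg g (a + 1) (c + 1) := by
  by_cases hc : c + 1 ≤ g
  · rw [pp, if_pos ⟨⟨a, rfl⟩, ⟨c, rfl⟩, by omega, by omega⟩, if_pos (by omega)]
    congr 1 <;> omega
  · rw [pp, if_neg (by omega), Qg_eq_zero_of_lt _ (by omega)]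

theorem bb_three_one (g : ℕ) :
    bb g 3 1 = 6 * bb g 1 1 ^ 2 + 4 * bb g 1 2 + 2 * lam g 1 := by
  have h := four_mul_lam g 1 one_ne_zero
  simp only [bbConv, Finset.Nat.sum_antidiagonal_succ, Finset.HasAntidiagonal.antidiagonal_zero,
    Finset.sum_singleton, bb_index_zero, zero_add, Nat.reduceAdd] at h
  refine mul_left_cancel₀ (two_ne_zero (α := Bg g)) ?_
  linear_combination -h

theorem bb_two_one_sq (g : ℕ) :
    bb g 2 1 ^ 2 = 4 * bb g 1 1 ^ 3 + 4 * bb g 1 1 * bb g 1 2 - 4 * bb g 1 3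
      + 2 * Qg g 2 2 + 4 * lam g 1 * bb g 1 1 + 4 * lam g 2 := by
  have h := four_mul_lam g 2 two_ne_zero
  simp only [bbConv, Finset.Nat.sum_antidiagonal_succ, Finset.HasAntidiagonal.antidiagonal_zero,
    Finset.sum_singleton, bb_index_zero, zero_add, Nat.reduceAdd] at h
  simp only [Qg, Nat.reduceAdd]
  linear_combination 2 * bb g 1 1 * bb_three_one g - h

theorem bb_two_one_mul_two (g : ℕ) :
    bb g 2 1 * bb g 2 2 = 4 * bb g 1 1 ^ 2 * bb g 1 2 + 2 * bb g 1 2 * bb g 1 2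
      + 4 * bb g 1 1 * bb g 1 3 - 2 * bb g 1 4 - bb g 1 1 * Qg g 2 2
      + Qg g 2 3 + 2 * lam g 1 * bb g 1 2 + 2 * lam g 3 := by
  have h := four_mul_lam g 3 three_ne_zero
  simp only [bbConv, Finset.Nat.sum_antidiagonal_succ, Finset.HasAntidiagonal.antidiagonal_zero,
    Finset.sum_singleton, bb_index_zero, zero_add, Nat.reduceAdd] at h
  simp only [Qg, Nat.reduceAdd]
  refine mul_left_cancel₀ (two_ne_zero (α := Bg g)) ?_
  linear_combination 2 * bb g 1 2 * bb_three_one g - h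

/-- the defining relations among the b's, p's and λ's hold in B_g,
and hence the generating-function formula computes the polynomial map ρ_g. -/
theorem stmt2 (g : ℕ) (hg : 1 ≤ g) :
    -- (1)
    bv g 3 1 = 6 * bv g 1 1 ^ 2 + 4 * bv g 1 3 + 2 * lam g 1 ∧
    -- (2)
    (∀ k, Odd k → 3 ≤ k → k ≤ 2 * g - 1 →
      bv g 3 k = 6 * bv g 1 1 * bv g 1 k + 6 * bv g 1 (k + 2) - pp g 3 k) ∧
    -- (3)
    bv g 2 1 ^ 2 = 4 * bv g 1 1 ^ 3 + 4 * bv g 1 1 * bv g 1 3 - 4 * bv g 1 5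
      + 2 * pp g 3 3 + 4 * lam g 1 * bv g 1 1 + 4 * lam g 2 ∧
    -- (4)
    (∀ k, Odd k → 3 ≤ k → k ≤ 2 * g - 1 →
      bv g 2 1 * bv g 2 k = 4 * bv g 1 1 ^ 2 * bv g 1 k + 2 * bv g 1 3 * bv g 1 k
        + 4 * bv g 1 1 * bv g 1 (k + 2) - 2 * bv g 1 (k + 4) - bv g 1 1 * pp g 3 k
        + 2 * pp g 3 (k + 2) - pp g 5 k + 2 * lam g 1 * bv g 1 k
        + 2 * lam g 3 * (if k = 3 then 1 else 0)) ∧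
    -- (5)  (here λ_{j+k+4} = lam g ((j+k+2)/2))
    (∀ j k, Odd j → Odd k → 3 ≤ j → j ≤ k → k ≤ 2 * g - 1 →
      bv g 2 j * bv g 2 k = 4 * bv g 1 1 * bv g 1 j * bv g 1 k
        + 4 * bv g 1 k * bv g 1 (j + 2) + 4 * bv g 1 j * bv g 1 (k + 2)
        + 2 * pp g (k + 2) (j + 2) - bv g 1 j * pp g 3 k - bv g 1 k * pp g 3 j
        - pp g k (j + 4) - pp g j (k + 4)
        + 2 * lam g ((j + k + 2) / 2) * (2 * (if j = k then 1 else 0)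
            + (if k = j - 2 then 1 else 0) + (if j = k - 2 then 1 else 0))) := by
  have h1 (i) : bv g i 1 = bb g i 1 := bv_odd g i 0
  have h3 (i) : bv g i 3 = bb g i 2 := bv_odd g i 1
  have h5 (i) : bv g i 5 = bb g i 3 := bv_odd g i 2
  have hp3 (c : ℕ) (hc : 1 ≤ c) : pp g 3 (2 * c + 1) = Qg g 2 (c + 1) := pp_odd g hc
  have hp5 (c : ℕ) (hc : 2 ≤ c) : pp g 5 (2 * c + 1) = Qg g 3 (c + 1) := pp_odd g hc
  have s2 (c : ℕ) : 2 * c + 1 + 2 = 2 * (c + 1) + 1 := by ring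
  have s4 (c : ℕ) : 2 * c + 1 + 4 = 2 * (c + 2) + 1 := by ring
  simp only [h1, h3, h5]
  refine ⟨bb_three_one g, ?_, ?_, ?_, ?_⟩
  · rintro k ⟨c, rfl⟩ hk -
    rw [s2, bv_odd, bv_odd, bv_odd, hp3 c (by omega), Qg]
    ring
  · rw [hp3 1 le_rfl]
    exact bb_two_one_sq g
  · rintro k ⟨c, rfl⟩ hk -
    rw [s2, s4, bv_odd, bv_odd, bv_odd, bv_odd, hp3 c (by omega), hp3 (c + 1) (by omega)]
    obtain rfl | hc : c = 1 ∨ 2 ≤ c := by omega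
    · rw [pp_comm, pp_odd g (by norm_num : 1 ≤ 2)]
      simp only [mul_one, Nat.reduceAdd, if_true]
      linear_combination bb_two_one_mul_two g
    · rw [hp5 c hc, if_neg (by omega)]
      simp only [Qg, add_assoc, Nat.reduceAdd]
      linear_combination bb g 1 (c + 1) * bb_three_one g
  · rintro j k ⟨a, rfl⟩ ⟨c, rfl⟩ hj hjk -
    obtain ⟨a, rfl⟩ : ∃ b, a = b + 1 := ⟨a - 1, by omega⟩
    obtain ⟨d, rfl⟩ : ∃ d, c = a + 1 + d := ⟨c - (a + 1), by omega⟩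
    rw [hp3 _ (by omega), hp3 _ (by omega), pp_comm g _ (2 * (a + 1) + 1 + 2)]
    simp only [s2, s4, bv_odd]
    rw [pp_odd g (by omega : a + 1 + 1 ≤ a + 1 + d + 1),
      pp_odd g (by omega : a + 1 ≤ a + 1 + d + 2), if_neg (by omega : ¬ _ = _ - 2), Qg_two, Qg_two]
    match d with
    | 0 =>
      rw [pp_odd g (by omega : a + 1 + 0 ≤ a + 1 + 2), if_pos (by omega), if_neg (by omega),
        show (2 * (a + 1) + 1 + (2 * (a + 1 + 0) + 1) + 2) / 2 = 2 * a + 4 by omega]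
      have h := Qg_diag g a
      simp only [recTerm, add_assoc, Nat.reduceAdd] at h ⊢
      linear_combination h
    | 1 =>
      rw [pp_odd g (by omega : a + 1 + 1 ≤ a + 1 + 2), if_neg (by omega), if_pos (by omega),
        show (2 * (a + 1) + 1 + (2 * (a + 1 + 1) + 1) + 2) / 2 = 2 * a + 5 by omega]
      have h := Qg_offdiag g a
      simp only [recTerm, add_assoc, Nat.reduceAdd] at h ⊢
      linear_combination h
    | d + 2 =>
      rw [pp_comm g _ (2 * (a + 1 + 2) + 1), pp_odd g (by omega : a + 1 + 2 ≤ a + 1 + (d + 2)),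
        if_neg (by omega), if_neg (by omega)]
      have h := Qg_add_four g a (a + d + 4)
      rw [show a + 1 + (d + 2) = a + d + 3 by ring]
      simp only [recTerm, add_assoc, Nat.reduceAdd] at h ⊢
      linear_combination h

end
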